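/- Let (X,≤) be a totally ordered set, k ≥ 2, and F : Xᵏ → X an associative, idempotent, symmetric, and ≤-preserving k-ary operation. Then F is reducible to the binary operation G(x,y) = F(x,...,x,y), i.e., F(x₁,...,x_k) = G(G(...G(x₁,x₂)...,x_{k−1}),x_k), and G is associative, idempotent, symmetric, and ≤-preserving. -/

import Mathlib

namespace SymmetricOperation

variable {X : Type*} {m : ℕ} {f : Multiset X → X}

open Multiset

/-- The binary operation `G(x, y) = F(x, …, x, y)`, for `F` of arity `m + 2` given as a
function on multisets. -/
def binary (m : ℕ) (f : Multiset X → X) (x y : X) : X := f (y ::ₘ replicate (m + 1) x)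

/-- Letters may be exchanged between the two levels of a nested expression. -/
def Exchange (m : ℕ) (f : Multiset X → X) : Prop :=
  ∀ (a b : X) (r q : Multiset X), card r = m + 1 → card q = m →
    f (f (a ::ₘ r) ::ₘ b ::ₘ q) = f (f (b ::ₘ r) ::ₘ a ::ₘ q)

/-- The inner and outer contexts of a nested expression may be interchanged. -/
def Interchange (m : ℕ) (f : Multiset X → X) : Prop :=
  ∀ (a : X) (r t : Multiset X), card r = m + 1 → card t = m + 1 →
    f (f (a ::ₘ r) ::ₘ t) = f (f (a ::ₘ t) ::ₘ r)

/-- Idempotency of an operation of arity `m + 2`. -/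
def Idempotent (m : ℕ) (f : Multiset X → X) : Prop := ∀ a, f (replicate (m + 2) a) = a

theorem binary_self (hid : Idempotent m f) (x : X) : binary m f x x = x := hid x

theorem binary_binary_self (hex : Exchange m f) (hid : Idempotent m f) (x z : X) :
    binary m f x (binary m f x z) = binary m f x z := by
  have h := hex z x (replicate (m + 1) x) (replicate m x) (by simp) (by simp)
  have hx : f (x ::ₘ replicate (m + 1) x) = x := hid x
  rw [hx, cons_swap x, ← replicate_succ] at h
  exact h

theorem binary_left_comm (hin : Interchange m f) (x y z : X) :
    binary m f x (binary m f y z) = binary m f y (binary m f x z) :=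
  hin z _ _ (by simp) (by simp)

theorem cons_binary (hex : Exchange m f) (x y z : X) (w : Multiset X) (hw : card w = m) :
    f (binary m f x y ::ₘ z ::ₘ w) = f (y ::ₘ binary m f x z ::ₘ w) := by
  rw [cons_swap y]
  exact hex y z _ w (by simp) hw

theorem replicate_binary_add (hex : Exchange m f) (x y z : X) (hz : binary m f x z = z) (j : ℕ)
    (w : Multiset X) (hw : card w + j = m + 1) :
    f (z ::ₘ (replicate j (binary m f x y) + w)) = f (z ::ₘ (replicate j y + w)) := by
  induction j generalizing w with
  | zero => simp
  | succ j ih =>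
    rw [replicate_succ, cons_add, cons_swap, cons_binary hex _ _ _ _ (by simp; omega), hz,
      cons_swap, ← add_cons, ih _ (by simp; omega), add_cons, replicate_succ, cons_add]

theorem binary_binary_left (hex : Exchange m f) (hid : Idempotent m f) (x y z : X) :
    binary m f (binary m f x y) z = binary m f y (binary m f x z) := by
  have h := replicate_binary_add hex x y (binary m f x z) (binary_binary_self hex hid x z) m {y}
    (by simp [add_comm])
  have hs (a : X) : replicate m a + {y} = y ::ₘ replicate m a := by
    rw [add_comm, singleton_add]
  rw [hs, hs, ← replicate_succ, cons_swap, ← cons_binary hex _ _ _ _ (by simp), cons_swap,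
    ← replicate_succ] at h
  exact h

variable [LinearOrder X]

/-- Monotonicity in one argument of an operation of arity `m + 2`. -/
def Mono (m : ℕ) (f : Multiset X → X) : Prop :=
  ∀ (x y : X) (s : Multiset X), card s = m + 1 → x ≤ y → f (x ::ₘ s) ≤ f (y ::ₘ s)

theorem replicate_add_le (hmono : Mono m f) {x y : X} (h : x ≤ y) (j : ℕ) (w : Multiset X)
    (hw : card w + j = m + 2) : f (replicate j x + w) ≤ f (replicate j y + w) := by
  induction j generalizing w with
  | zero => simp
  | succ j ih =>
    have h' := ih (x ::ₘ w) (by simp; omega)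
    rw [replicate_succ, replicate_succ, cons_add, cons_add]
    rw [add_cons, add_cons] at h'
    exact h'.trans (hmono _ _ _ (by simp; omega) h)

theorem binary_le_binary (hmono : Mono m f) {x y z t : X} (hxz : x ≤ z) (hyt : y ≤ t) :
    binary m f x y ≤ binary m f z t := by
  have h := replicate_add_le hmono hxz (m + 1) {y} (by simp; omega)
  simp only [add_comm _ ({y} : Multiset X), singleton_add] at h
  exact h.trans (hmono _ _ _ (by simp) hyt)

theorem binary_le_binary_swap (hmono : Mono m f) {x y : X} (h : x ≤ y) :
    binary m f x y ≤ binary m f y x := by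
  have h := replicate_add_le hmono h m (x ::ₘ {y}) (by simp [add_comm])
  have hx : replicate m x + x ::ₘ {y} = y ::ₘ replicate (m + 1) x := by
    rw [add_cons, add_comm, singleton_add, cons_swap, replicate_succ]
  have hy : replicate m y + x ::ₘ {y} = x ::ₘ replicate (m + 1) y := by
    rw [add_cons, add_comm, singleton_add, replicate_succ]
  rwa [hx, hy] at h

theorem binary_comm (hex : Exchange m f) (hin : Interchange m f) (hid : Idempotent m f)
    (hmono : Mono m f) (x y : X) : binary m f x y = binary m f y x := by
  have absorb (x y : X) :
      binary m f (binary m f y x) (binary m f x y) = binary m f x y := by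
    rw [binary_binary_left hex hid, binary_left_comm hin y, binary_self hid,
      binary_binary_self hex hid]
  have of_le {x y : X} (h : x ≤ y) : binary m f x y = binary m f y x := by
    have h₁ := binary_le_binary_swap hmono h
    have h₂ := binary_le_binary_swap hmono h₁
    rw [absorb, absorb] at h₂
    exact le_antisymm h₁ h₂
  rcases le_total x y with h | h
  · exact of_le h
  · exact (of_le h).symm

theorem cons_cons_binary (hex : Exchange m f) (hin : Interchange m f) (hid : Idempotent m f)
    (hmono : Mono m f) (x y : X) (w : Multiset X) (hw : card w = m) :
    f (binary m f x y ::ₘ binary m f x y ::ₘ w) = f (x ::ₘ y ::ₘ w) := by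
  rw [cons_binary hex _ _ _ _ hw, binary_binary_self hex hid, cons_swap,
    binary_comm hex hin hid hmono, cons_binary hex _ _ _ _ hw, binary_self hid]

theorem replicate_add_of_absorb (hex : Exchange m f) (hin : Interchange m f)
    (hid : Idempotent m f) (hmono : Mono m f) {g h : X} (hgh : binary m f g h = h) (j : ℕ)
    (w : Multiset X) (hw : card w + j = m + 1) :
    f (h ::ₘ (replicate j g + w)) = f (h ::ₘ (replicate j h + w)) := by
  induction j generalizing w with
  | zero => simp
  | succ j ih =>
    rw [replicate_succ, cons_add, cons_swap, ← cons_cons_binary hex hin hid hmono _ _ _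
      (by simp; omega), hgh, ← add_cons, ih _ (by simp; omega), add_cons, replicate_succ, cons_add]

theorem binary_assoc (hex : Exchange m f) (hin : Interchange m f) (hid : Idempotent m f)
    (hmono : Mono m f) (x y z : X) :
    binary m f x (binary m f y z) = binary m f (binary m f x y) z := by
  rw [binary_comm hex hin hid hmono x y, binary_binary_left hex hid]

theorem eq_foldl_binary (hex : Exchange m f) (hin : Interchange m f) (hid : Idempotent m f)
    (hmono : Mono m f) (l : List X) (g : X) (j : ℕ) (hl : l.length + j = m + 1) :
    f (replicate (j + 1) g + l) = l.foldl (binary m f) g := by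
  induction l generalizing g j with
  | nil =>
    obtain rfl : j = m + 1 := by simpa using hl
    simpa using hid g
  | cons a l ih =>
    simp only [List.length_cons] at hl
    rw [List.foldl_cons, ← ih _ (j + 1) (by omega), ← cons_coe, replicate_succ, cons_add, add_cons,
      ← cons_cons_binary hex hin hid hmono _ _ _ (by simp; omega),
      replicate_succ _ (j + 1), replicate_succ, cons_add, cons_add, ← add_cons,
      replicate_add_of_absorb hex hin hid hmono (binary_binary_self hex hid _ _) j _
        (by simp; omega), add_cons]

/-- A symmetric operation is induced by a function on multisets. -/
theorem exists_multiset_fun {X : Type*} [LinearOrder X] [Nonempty X] {n : ℕ} (F : (Fin n → X) → X)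
    (hsym : ∀ (x : Fin n → X) (σ : Equiv.Perm (Fin n)), F (x ∘ σ) = F x) :
    ∃ f : Multiset X → X, ∀ x : Fin n → X, f (List.ofFn x) = F x := by
  have hfac : F.FactorsThrough fun x : Fin n → X => (List.ofFn x : Multiset X) := by
    intro x y hxy
    have hxy' : (List.ofFn x).Perm (List.ofFn y) := Multiset.coe_eq_coe.mp hxy
    have h : x ∘ Tuple.sort x = y ∘ Tuple.sort y := List.ofFn_injective <|
      ((((Tuple.sort x).ofFn_comp_perm x).trans hxy').trans
        ((Tuple.sort y).ofFn_comp_perm y).symm).eq_of_pairwise'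
        (Tuple.monotone_sort x).sortedLE_ofFn.pairwise
        (Tuple.monotone_sort y).sortedLE_ofFn.pairwise
    rw [← hsym x (Tuple.sort x), h, hsym]
  exact ⟨Function.extend _ F fun _ => Classical.arbitrary X, fun x =>
    hfac.extend_apply (fun _ => Classical.arbitrary X) x⟩

theorem exists_ofFn_eq {X : Type*} {n : ℕ} (s : Multiset X) (hs : Multiset.card s = n) :
    ∃ x : Fin n → X, (List.ofFn x : Multiset X) = s := by
  induction s using Quotient.inductionOn with
  | h l =>
    subst hs
    exact ⟨l.get, by simp⟩

/-- The argument tuple of the nested expression in which the block `v` of `u ++ v ++ w` is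
evaluated first. -/
theorem ofFn_nested {X : Type*} {m : ℕ} {f : Multiset X → X} (u v w : List X)
    (hv : v.length = m + 2) (huw : u.length + w.length = m + 1) :
    (List.ofFn fun t : Fin (m + 2) =>
      if t.val < u.length then (u ++ v ++ w)[t.val]'(by simp; omega)
      else if t.val = u.length then
        f (List.ofFn fun s : Fin (m + 2) => (u ++ v ++ w)[u.length + s.val]'(by simp; omega))
      else (u ++ v ++ w)[t.val + (m + 2) - 1]'(by simp; omega)) = u ++ f v :: w := by
  have hinner : (List.ofFn fun s : Fin (m + 2) =>
      (u ++ v ++ w)[u.length + s.val]'(by simp; omega)) = v := by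
    apply List.ext_getElem
    · simp [hv]
    · intro t ht ht'
      rw [List.getElem_ofFn]
      grind
  rw [hinner]
  apply List.ext_getElem
  · simp; omega
  · intro t ht ht'
    rw [List.getElem_ofFn]
    clear hinner
    simp only [List.getElem_append, List.getElem_cons, List.length_append]
    grind

end SymmetricOperation

open SymmetricOperation

/-- Every associative, idempotent, symmetric, order-preserving k-ary operation
on a chain is reducible to the binary operation G(x,y) = F(x,...,x,y), which is
itself associative, idempotent, symmetric, and order-preserving. -/
theorem stmt_17 {X : Type*} [LinearOrder X] (k : ℕ) (hk : 2 ≤ k)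
    (F : (Fin k → X) → X)
    (hassoc : ∀ (x : Fin (2 * k - 1) → X) (i i' : Fin k),
      F (fun t : Fin k =>
        if t.val < i.val then x ⟨t.val, by have := t.isLt; omega⟩
        else if t.val = i.val then
          F (fun s : Fin k => x ⟨i.val + s.val, by
            have := i.isLt; have := s.isLt; omega⟩)
        else x ⟨t.val + k - 1, by have := t.isLt; omega⟩) =
      F (fun t : Fin k =>
        if t.val < i'.val then x ⟨t.val, by have := t.isLt; omega⟩
        else if t.val = i'.val then
          F (fun s : Fin k => x ⟨i'.val + s.val, by
            have := i'.isLt; have := s.isLt; omega⟩)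
        else x ⟨t.val + k - 1, by have := t.isLt; omega⟩))
    (hsym : ∀ (x : Fin k → X) (σ : Equiv.Perm (Fin k)), F (x ∘ σ) = F x)
    (hidem : ∀ c : X, F (fun _ => c) = c)
    (hmono : ∀ x y : Fin k → X, (∀ i, x i ≤ y i) → F x ≤ F y) :
    ∃ G : X → X → X,
      (∀ x y : X, G x y = F (fun i => if i.val = k - 1 then y else x)) ∧
      (∀ x : Fin k → X,
        F x = List.foldl G (x ⟨0, by omega⟩) (List.ofFn x).tail) ∧
      (∀ x y z, G x (G y z) = G (G x y) z) ∧
      (∀ x y, G x y = G y x) ∧ (∀ x, G x x = x) ∧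
      (∀ x y z t : X, x ≤ z → y ≤ t → G x y ≤ G z t) := by
  obtain ⟨m, rfl⟩ := Nat.exists_eq_add_of_le' hk
  rcases isEmpty_or_nonempty X with hX | hX
  · exact ⟨fun x _ => x, fun x => hX.elim x, fun x => hX.elim (x 0), fun x => hX.elim x,
      fun x => hX.elim x, fun x => hX.elim x, fun x => hX.elim x⟩
  obtain ⟨f, hf⟩ := exists_multiset_fun F hsym
  have nested (u v w u' v' w' : List X) (hv : v.length = m + 2) (hv' : v'.length = m + 2)
      (huw : u.length + w.length = m + 1) (heq : u ++ v ++ w = u' ++ v' ++ w') :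
      f (u ++ f v :: w : List X) = f (u' ++ f v' :: w' : List X) := by
    have hlen : (u ++ v ++ w).length = 2 * (m + 2) - 1 := by simp; omega
    have hlen' := congrArg List.length heq
    simp only [List.length_append] at hlen'
    have h := hassoc (fun j => (u ++ v ++ w)[j.val]) ⟨u.length, by omega⟩ ⟨u'.length, by omega⟩
    simp only [← hf] at h
    rw [ofFn_nested u v w hv huw] at h
    simp only [heq] at h
    rwa [ofFn_nested u' v' w' hv' (by omega)] at h
  have hex : Exchange m f := by
    intro a b r q hr hq
    induction r using Quotient.inductionOn with | h r =>
    induction q using Quotient.inductionOn with | h q =>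
    have hr : r.length = m + 1 := hr
    have hq : q.length = m := hq
    have h := nested [] (a :: r) (b :: q) [a] (r ++ [b]) q 
      (by simp [hr]) (by simp [hr]) (by simp [hq]) (by simp)
    have hs : (↑(r ++ [b]) : Multiset X) = b ::ₘ ↑r :=
      Multiset.coe_eq_coe.mpr (List.perm_append_singleton b r)
    rw [hs] at h
    exact h.trans (congrArg f (Multiset.cons_swap a _ (q : Multiset X)))
  have hin : Interchange m f := by
    intro a r t hr ht
    induction r using Quotient.inductionOn with | h r =>
    induction t using Quotient.inductionOn with | h t =>
    have hr : r.length = m + 1 := hr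
    have ht : t.length = m + 1 := ht
    have h := nested [] (r ++ [a]) t r (a :: t) [] 
      (by simp [hr]) (by simp [ht]) (by simp [ht]) (by simp)
    have hs (b : X) : (↑(r ++ [b]) : Multiset X) = b ::ₘ ↑r :=
      Multiset.coe_eq_coe.mpr (List.perm_append_singleton b r)
    rw [hs, hs] at h
    exact h
  have hid : Idempotent m f := by
    intro a
    have h := hidem a
    rwa [← hf, List.ofFn_const, Multiset.coe_replicate] at h
  have hmon : Mono m f := by
    intro x y s hs hxy
    obtain ⟨z, rfl⟩ := exists_ofFn_eq s hs
    have h := hmono (Fin.cons x z) (Fin.cons y z) (Fin.cases hxy fun _ => le_rfl)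
    rw [← hf, ← hf] at h
    simpa [List.ofFn_succ] using h
  refine ⟨binary m f, fun x y => ?_, fun x => ?_, binary_assoc hex hin hid hmon,
    binary_comm hex hin hid hmon, binary_self hid, fun x y z t => binary_le_binary hmon⟩
  · rw [← hf, List.ofFn_succ']
    have hlt (i : Fin (m + 1)) : i.val ≠ m + 1 := i.isLt.ne
    simp only [Fin.val_castSucc, Fin.val_last, Nat.add_succ_sub_one, hlt, if_true, if_false,
      List.ofFn_const, List.concat_eq_append]
    exact congrArg f (Multiset.coe_eq_coe.mpr (List.perm_append_singleton y _)).symm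
  · rw [← hf, ← eq_foldl_binary hex hin hid hmon _ _ 0 (by simp)]
    simp [List.ofFn_succ]
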